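/- arXiv:1608.00875 — 2 statements merged into one kernel-verified Lean document; each statement's English description precedes it below -/
import Mathlib

section
/- The operators f_n satisfy the cubic relation 3[f_2, f_1] − [f_3, f_0] + (ħ² + t(ħ+t))[f_1, f_0] − ħt(ħ+t)·f_0² = 0 as k₀-linear endomorphisms of K. -/
/-!
Setup: `k0 l` is the field k₀ = ℂ(ħ, t, z₁, …, z_l) and `KK l N` is the field
K = ℂ(ħ, t, z₁, …, z_l, w₁, …, w_N), realized as the rational function field in
w₁, …, w_N over k₀.  Operators are k₀-linear endomorphisms of K, products of
operators denote composition, and `[A, B] = A * B - B * A`.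
-/

open MvPolynomial Finset

set_option synthInstance.maxHeartbeats 1000000
set_option maxHeartbeats 2000000

noncomputable section

/-- The coefficient field k₀ = ℂ(ħ, t, z₁, …, z_l). -/
def k0 (l : ℕ) : Type := FractionRing (MvPolynomial (Fin 2 ⊕ Fin l) ℂ)

instance (l : ℕ) : Field (k0 l) := inferInstanceAs (Field (FractionRing _))
instance (l : ℕ) : Algebra (MvPolynomial (Fin 2 ⊕ Fin l) ℂ) (k0 l) :=
  inferInstanceAs (Algebra _ (FractionRing _))
instance (l : ℕ) : IsFractionRing (MvPolynomial (Fin 2 ⊕ Fin l) ℂ) (k0 l) :=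
  inferInstanceAs (IsFractionRing _ (FractionRing _))
instance (l : ℕ) : CharZero (k0 l) :=
  charZero_of_injective_algebraMap
    (IsFractionRing.injective (MvPolynomial (Fin 2 ⊕ Fin l) ℂ) (k0 l))

/-- The field K = ℂ(ħ, t, z₁, …, z_l, w₁, …, w_N), as k₀(w₁, …, w_N). -/
def KK (l N : ℕ) : Type := FractionRing (MvPolynomial (Fin N) (k0 l))

instance (l N : ℕ) : Field (KK l N) := inferInstanceAs (Field (FractionRing _))
instance (l N : ℕ) : Algebra (MvPolynomial (Fin N) (k0 l)) (KK l N) :=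
  inferInstanceAs (Algebra _ (FractionRing _))
instance (l N : ℕ) : IsFractionRing (MvPolynomial (Fin N) (k0 l)) (KK l N) :=
  inferInstanceAs (IsFractionRing _ (FractionRing _))
instance (l N : ℕ) : Algebra (k0 l) (KK l N) :=
  inferInstanceAs (Algebra _ (FractionRing (MvPolynomial (Fin N) (k0 l))))
instance (l N : ℕ) : IsScalarTower (k0 l) (MvPolynomial (Fin N) (k0 l)) (KK l N) :=
  inferInstanceAs (IsScalarTower _ _ (FractionRing _))
instance (l N : ℕ) : CharZero (KK l N) :=
  charZero_of_injective_algebraMap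
    (IsFractionRing.injective (MvPolynomial (Fin N) (k0 l)) (KK l N))

variable (l N : ℕ)

/-- ħ as an element of k₀. -/
def hb0 : k0 l := algebraMap (MvPolynomial (Fin 2 ⊕ Fin l) ℂ) (k0 l) (X (Sum.inl 0))
/-- t as an element of k₀. -/
def tt0 : k0 l := algebraMap (MvPolynomial (Fin 2 ⊕ Fin l) ℂ) (k0 l) (X (Sum.inl 1))
/-- z_k as an element of k₀. -/
def zz0 (k : Fin l) : k0 l := algebraMap (MvPolynomial (Fin 2 ⊕ Fin l) ℂ) (k0 l) (X (Sum.inr k))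

/-- ħ as an element of K. -/
def hbar : KK l N := algebraMap (k0 l) (KK l N) (hb0 l)
/-- t as an element of K. -/
def tt : KK l N := algebraMap (k0 l) (KK l N) (tt0 l)
/-- z_k as an element of K. -/
def zz (k : Fin l) : KK l N := algebraMap (k0 l) (KK l N) (zz0 l k)
/-- w_i as an element of K. -/
def ww (i : Fin N) : KK l N := algebraMap (MvPolynomial (Fin N) (k0 l)) (KK l N) (X i)

/-- The ring of k₀-linear endomorphisms of K; multiplication is composition. -/
abbrev Op (l N : ℕ) := Module.End (k0 l) (KK l N)

/-- The multiplication operator by an element of K. -/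
def mulOp (a : KK l N) : Op l N := LinearMap.mulLeft (k0 l) a

/-- w̄_i = w_i − (N−1)t (here l = 0, so K = ℂ(ħ, t, w₁, …, w_N)). -/
def wbar (i : Fin N) : KK 0 N := ww 0 N i - ((N - 1 : ℕ) : KK 0 N) * tt 0 N

variable (u : Fin N → (KK 0 N ≃ₐ[k0 0] KK 0 N))

/-- The operator e_n. -/
def eop (n : ℕ) : Op 0 N :=
  ∑ i : Fin N,
    mulOp 0 N ((wbar N i + hbar 0 N) ^ n *
      ∏ j ∈ ({i}ᶜ : Finset (Fin N)), (wbar N i - wbar N j - tt 0 N) / (wbar N i - wbar N j)) *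
      (u i).toLinearMap

/-- The operator f_n. -/
def fop (n : ℕ) : Op 0 N :=
  ∑ i : Fin N,
    mulOp 0 N ((wbar N i) ^ n *
      ∏ j ∈ ({i}ᶜ : Finset (Fin N)), (wbar N i - wbar N j + tt 0 N) / (wbar N i - wbar N j)) *
      (u i).symm.toLinearMap

/-- Two indeterminates never differ by a constant. -/
lemma ww_sub_ww_ne {i k : Fin N} (h : i ≠ k) (c : k0 l) :
    ww l N i - ww l N k ≠ algebraMap (k0 l) (KK l N) c := by
  intro e
  rw [IsScalarTower.algebraMap_apply (k0 l) (MvPolynomial (Fin N) (k0 l)) (KK l N), ww, ww,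
    ← map_sub] at e
  have e' := IsFractionRing.injective (MvPolynomial (Fin N) (k0 l)) (KK l N) e
  have := congrArg (MvPolynomial.eval (Pi.single i (c + 1))) e'
  simp [MvPolynomial.algebraMap_eq, h.symm] at this

/-- An algebra endomorphism of `K` is determined by its values on the indeterminates. -/
lemma algHom_ext_ww {f g : KK l N →ₐ[k0 l] KK l N} (h : ∀ i, f (ww l N i) = g (ww l N i)) :
    f = g := by
  have hp : f.comp (IsScalarTower.toAlgHom (k0 l) (MvPolynomial (Fin N) (k0 l)) (KK l N)) =
      g.comp (IsScalarTower.toAlgHom (k0 l) (MvPolynomial (Fin N) (k0 l)) (KK l N)) :=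
    MvPolynomial.algHom_ext h
  have hr : (f : KK l N →+* KK l N) = g :=
    IsLocalization.ringHom_ext (nonZeroDivisors (MvPolynomial (Fin N) (k0 l)))
      (RingHom.ext fun p => DFunLike.congr_fun hp p)
  exact AlgHom.ext fun x => RingHom.congr_fun hr x

lemma wbar_sub_wbar (i k : Fin N) : wbar N i - wbar N k = ww 0 N i - ww 0 N k := by
  simp [wbar]

lemma wbar_sub_wbar_ne_zero {i k : Fin N} (h : i ≠ k) : wbar N i - wbar N k ≠ 0 := by
  rw [wbar_sub_wbar]
  simpa using ww_sub_ww_ne 0 N h 0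

lemma wbar_sub_wbar_ne_hbar {i k : Fin N} (h : i ≠ k) : wbar N i - wbar N k ≠ hbar 0 N := by
  rw [wbar_sub_wbar]
  exact ww_sub_ww_ne 0 N h _

/-- The rational coefficient of `u_i⁻¹` in `f_0`. -/
def fcoeff (i : Fin N) : KK 0 N :=
  ∏ j ∈ ({i}ᶜ : Finset (Fin N)), (wbar N i - wbar N j + tt 0 N) / (wbar N i - wbar N j)

lemma fop_apply (n : ℕ) (g : KK 0 N) :
    fop N u n g = ∑ i, wbar N i ^ n * fcoeff N i * (u i).symm g := by
  simp only [fop, mulOp, fcoeff, LinearMap.sum_apply, Module.End.mul_apply,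
    LinearMap.mulLeft_apply, AlgEquiv.toLinearMap_apply]

/-- The part of `fcoeff N i` not involving the `k`-th variable. -/
def fcoeffErase (i k : Fin N) : KK 0 N :=
  ∏ j ∈ ({i, k}ᶜ : Finset (Fin N)), (wbar N i - wbar N j + tt 0 N) / (wbar N i - wbar N j)

lemma fcoeff_eq_mul {i k : Fin N} (h : i ≠ k) :
    fcoeff N i =
      (wbar N i - wbar N k + tt 0 N) / (wbar N i - wbar N k) * fcoeffErase N i k := by
  have hs : ({i}ᶜ : Finset (Fin N)) = insert k ({i, k}ᶜ) := by
    ext j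
    simp only [mem_compl, mem_singleton, mem_insert]
    grind
  rw [fcoeff, hs, prod_insert (by simp), fcoeffErase]

section Shift

variable {N u}

lemma symm_ww
    (hu : ∀ i j, u i (ww 0 N j) = ww 0 N j + if j = i then hbar 0 N else 0)
    (i j : Fin N) :
    (u i).symm (ww 0 N j) = ww 0 N j - if j = i then hbar 0 N else 0 := by
  rw [AlgEquiv.symm_apply_eq, map_sub, hu]
  split_ifs <;> simp [hbar]

lemma symm_comm
    (hu : ∀ i j, u i (ww 0 N j) = ww 0 N j + if j = i then hbar 0 N else 0)
    (i k : Fin N) (g : KK 0 N) :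
    (u i).symm ((u k).symm g) = (u k).symm ((u i).symm g) := by
  have h : (u i).symm.toAlgHom.comp (u k).symm.toAlgHom =
      (u k).symm.toAlgHom.comp (u i).symm.toAlgHom := by
    refine algHom_ext_ww 0 N fun j => ?_
    simp only [AlgHom.comp_apply, AlgEquiv.toAlgHom_apply, symm_ww hu, map_sub]
    split_ifs <;> simp [hbar]
  exact DFunLike.congr_fun h g

lemma symm_wbar
    (hu : ∀ i j, u i (ww 0 N j) = ww 0 N j + if j = i then hbar 0 N else 0)
    (i j : Fin N) :
    (u i).symm (wbar N j) = wbar N j - if j = i then hbar 0 N else 0 := by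
  simp only [wbar, map_sub, map_mul, map_natCast, symm_ww hu, tt, AlgEquiv.commutes]
  ring

lemma symm_wbar_self
    (hu : ∀ i j, u i (ww 0 N j) = ww 0 N j + if j = i then hbar 0 N else 0)
    (i : Fin N) : (u i).symm (wbar N i) = wbar N i - hbar 0 N := by
  simp [symm_wbar hu]

lemma symm_wbar_of_ne
    (hu : ∀ i j, u i (ww 0 N j) = ww 0 N j + if j = i then hbar 0 N else 0)
    {i j : Fin N} (h : j ≠ i) : (u i).symm (wbar N j) = wbar N j := by
  simp [symm_wbar hu, h]

lemma symm_fcoeff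
    (hu : ∀ i j, u i (ww 0 N j) = ww 0 N j + if j = i then hbar 0 N else 0)
    {i k : Fin N} (h : i ≠ k) :
    (u i).symm (fcoeff N k) =
      (wbar N k - wbar N i + hbar 0 N + tt 0 N) / (wbar N k - wbar N i + hbar 0 N) *
        fcoeffErase N k i := by
  have ht : (u i).symm (tt 0 N) = tt 0 N := (u i).symm.commutes _
  have he : (u i).symm (fcoeffErase N k i) = fcoeffErase N k i := by
    rw [fcoeffErase, map_prod]
    refine prod_congr rfl fun j hj => ?_
    have hj : j ≠ i := by simp at hj; exact hj.2
    simp [symm_wbar_of_ne hu hj, symm_wbar_of_ne hu h.symm, ht]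
  rw [fcoeff_eq_mul N h.symm, map_mul, he, map_div₀, map_add, map_sub, ht, symm_wbar_self hu,
    symm_wbar_of_ne hu h.symm, sub_sub_eq_add_sub, add_sub_right_comm]

lemma fop_fop_apply (n m : ℕ) (g : KK 0 N) :
    fop N u n (fop N u m g) = ∑ i, ∑ k, wbar N i ^ n * (u i).symm (wbar N k) ^ m *
      (fcoeff N i * (u i).symm (fcoeff N k) * (u i).symm ((u k).symm g)) := by
  rw [fop_apply N u n, fop_apply N u m]
  simp only [map_sum, map_mul, map_pow, mul_sum]
  exact sum_congr rfl fun i _ => sum_congr rfl fun k _ => by ring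

end Shift

/-- The cubic polynomial whose values at `(w̄_i, u_i⁻¹ w̄_k)` weigh the terms of the relation. -/
def cubic (x y : KK 0 N) : KK 0 N :=
  -((x - y - hbar 0 N) * (x - y - tt 0 N) * (x - y + hbar 0 N + tt 0 N))

lemma sum_sum_eq_zero_of_antisymm {ι R : Type*} [Fintype ι] [Field R] [CharZero R]
    {F : ι → ι → R} (h : ∀ i k, F i k = -F k i) : ∑ i, ∑ k, F i k = 0 := by
  rw [← self_eq_neg]
  conv_lhs => rw [sum_comm]
  simp_rw [← sum_neg_distrib]
  exact sum_congr rfl fun i _ => sum_congr rfl fun k _ => h k i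

theorem statement8 (hN : 1 ≤ N)
    (hu : ∀ i j, u i (ww 0 N j) = ww 0 N j + if j = i then hbar 0 N else 0) :
    3 • (fop N u 2 * fop N u 1 - fop N u 1 * fop N u 2)
      - (fop N u 3 * fop N u 0 - fop N u 0 * fop N u 3)
      + mulOp 0 N (hbar 0 N ^ 2 + tt 0 N * (hbar 0 N + tt 0 N)) *
          (fop N u 1 * fop N u 0 - fop N u 0 * fop N u 1)
      - mulOp 0 N (hbar 0 N * tt 0 N * (hbar 0 N + tt 0 N)) * (fop N u 0) ^ 2 = 0 := by
  ext g
  have key : ∑ i, ∑ k, cubic N (wbar N i) ((u i).symm (wbar N k)) *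
      (fcoeff N i * (u i).symm (fcoeff N k) * (u i).symm ((u k).symm g)) = 0 := by
    refine sum_sum_eq_zero_of_antisymm fun i k => ?_
    obtain rfl | h := eq_or_ne i k
    · simp [cubic, symm_wbar_self hu]
    · rw [symm_comm hu k i, symm_fcoeff hu h, symm_fcoeff hu h.symm, fcoeff_eq_mul N h,
        fcoeff_eq_mul N h.symm, symm_wbar_of_ne hu h, symm_wbar_of_ne hu h.symm, cubic, cubic]
      have h1 := wbar_sub_wbar_ne_zero N h
      have h2 := wbar_sub_wbar_ne_zero N h.symm
      have h3 : wbar N k - wbar N i + hbar 0 N ≠ 0 := fun e =>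
        wbar_sub_wbar_ne_hbar N h (by linear_combination -e)
      have h4 : wbar N i - wbar N k + hbar 0 N ≠ 0 := fun e =>
        wbar_sub_wbar_ne_hbar N h.symm (by linear_combination -e)
      field_simp
      ring
  simp only [LinearMap.add_apply, LinearMap.sub_apply, LinearMap.smul_apply, Module.End.mul_apply,
    LinearMap.zero_apply, mulOp, LinearMap.mulLeft_apply, pow_two (fop N u 0), fop_fop_apply]
  rw [← key]
  simp only [nsmul_eq_mul, mul_sum, ← sum_sub_distrib, ← sum_add_distrib]
  refine sum_congr rfl fun i _ => sum_congr rfl fun k _ => ?_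
  rw [cubic]
  push_cast
  ring
end
end

section
/- The operators e_n satisfy the Serre-type relation [e_0, [e_0, e_1]] = 0 as k₀-linear endomorphisms of K. -/
/-!
Setup: `k0 l` is the field k₀ = ℂ(ħ, t, z₁, …, z_l) and `KK l N` is the field
K = ℂ(ħ, t, z₁, …, z_l, w₁, …, w_N), realized as the rational function field in
w₁, …, w_N over k₀.  Operators are k₀-linear endomorphisms of K, products of
operators denote composition, and `[A, B] = A * B - B * A`.
-/

open MvPolynomial Finset

set_option synthInstance.maxHeartbeats 1000000
set_option maxHeartbeats 2000000

noncomputable section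

variable (l N : ℕ)

variable (u : Fin N → (KK 0 N ≃ₐ[k0 0] KK 0 N))

section ShiftOperators

variable {K ι : Type*} [Field K] [Fintype ι] [DecidableEq ι]

/-- The interaction factor `(x_i - x_j - t) / (x_i - x_j)`. -/
def pairFactor (x : ι → K) (t : K) (i j : ι) : K := (x i - x j - t) / (x i - x j)

/-- The coefficient of `u_i` in `e_0`. -/
def shiftCoeff (x : ι → K) (t : K) (i : ι) : K := ∏ j ∈ ({i}ᶜ : Finset ι), pairFactor x t i j

/-- The contribution of `u_i u_j u_k` to `[e_0, [e_0, e_1]]` applied to `f`. -/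
def serreTerm (u : ι → K →+* K) (x : ι → K) (h t : K) (f : K) (i j k : ι) : K :=
  (u i (u j (x k + h)) - 2 * u i (x j + h) + (x i + h)) *
    (shiftCoeff x t i * u i (shiftCoeff x t j) * u i (u j (shiftCoeff x t k)) *
      u i (u j (u k f)))

omit [Fintype ι] [DecidableEq ι] in
theorem map_pairFactor (σ : K →+* K) (x : ι → K) (t : K) (ht : σ t = t) (i j : ι) :
    σ (pairFactor x t i j) = (σ (x i) - σ (x j) - t) / (σ (x i) - σ (x j)) := by
  simp [pairFactor, ht]

omit [Fintype ι] in
theorem map_prod_pairFactor {u : ι → K →+* K} {x : ι → K} {h t : K}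
    (hx : ∀ i j, u i (x j) = x j + if j = i then h else 0) (ht : ∀ i, u i t = t)
    {S : Finset ι} {i j : ι} (hij : i ≠ j) (hj : j ∉ S) :
    u j (∏ l ∈ S, pairFactor x t i l) = ∏ l ∈ S, pairFactor x t i l := by
  rw [map_prod]
  refine Finset.prod_congr rfl fun l hl => ?_
  have hlj : l ≠ j := fun e => hj (e ▸ hl)
  rw [map_pairFactor _ _ _ (ht j), hx, hx, if_neg hij, if_neg hlj]
  simp [pairFactor]

theorem shiftCoeff_eq_of_pair (x : ι → K) (t : K) {i j : ι} (hij : i ≠ j) :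
    shiftCoeff x t i = pairFactor x t i j * ∏ l ∈ ({i, j}ᶜ : Finset ι), pairFactor x t i l := by
  have : ({i}ᶜ : Finset ι) = insert j ({i, j}ᶜ : Finset ι) := by
    ext l; by_cases l = j <;> simp_all [eq_comm]
  rw [shiftCoeff, this, Finset.prod_insert (by simp)]

theorem shiftCoeff_eq_of_triple (x : ι → K) (t : K) {i j k : ι} (hij : i ≠ j) (hik : i ≠ k)
    (hjk : j ≠ k) :
    shiftCoeff x t i = pairFactor x t i j * pairFactor x t i k *
      ∏ l ∈ ({i, j, k}ᶜ : Finset ι), pairFactor x t i l := by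
  have : ({i, j}ᶜ : Finset ι) = insert k ({i, j, k}ᶜ : Finset ι) := by
    ext l; by_cases l = k <;> simp_all [eq_comm]
  rw [shiftCoeff_eq_of_pair x t hij, this, Finset.prod_insert (by simp), mul_assoc]

/-- The three-variable identity behind the Serre relation, on pairwise distinct indices. -/
theorem serre_identity_of_distinct {a b c h t : K}
    (hab : a - b ≠ 0) (hac : a - c ≠ 0) (hbc : b - c ≠ 0)
    (hab' : a - b - h ≠ 0) (hac' : a - c - h ≠ 0) (hbc' : b - c - h ≠ 0)
    (hba' : b - a - h ≠ 0) (hca' : c - a - h ≠ 0) (hcb' : c - b - h ≠ 0) :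
    let p : K → K → K := fun y z => (y - z - t) / (y - z) * ((z - y - h - t) / (z - y - h))
    (c - 2 * b + a) * (p a b * p a c * p b c) + (b - 2 * c + a) * (p a c * p a b * p c b) +
    (c - 2 * a + b) * (p b a * p b c * p a c) + (a - 2 * c + b) * (p b c * p b a * p c a) +
    (b - 2 * a + c) * (p c a * p c b * p a b) + (a - 2 * b + c) * (p c b * p c a * p b a) = 0 := by
  intro p
  have key : ∀ y z : K, y - z ≠ 0 → y - z - h ≠ 0 → z - y - h ≠ 0 →
      p y z = (y - z - t) * (z - y - h - t) * (y - z - h) *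
        ((y - z) * (y - z - h) * (z - y - h))⁻¹ := by
    intro y z h1 h2 h3
    simp only [p]
    field_simp
  have key' : ∀ y z : K, y - z ≠ 0 → y - z - h ≠ 0 → z - y - h ≠ 0 →
      p z y = -((z - y - t) * (y - z - h - t) * (z - y - h) *
        ((y - z) * (y - z - h) * (z - y - h))⁻¹) := by
    intro y z h1 h2 h3
    have h4 : z - y ≠ 0 := by rw [← neg_sub]; exact neg_ne_zero.mpr h1
    simp only [p]
    field_simp
    ring
  rw [key a b hab hab' hba', key' a b hab hab' hba', key a c hac hac' hca',
    key' a c hac hac' hca', key b c hbc hbc' hcb', key' b c hbc hbc' hcb']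
  generalize ((a - b) * (a - b - h) * (b - a - h))⁻¹ = r
  generalize ((a - c) * (a - c - h) * (c - a - h))⁻¹ = s
  generalize ((b - c) * (b - c - h) * (c - b - h))⁻¹ = q
  obtain ⟨m, rfl⟩ : ∃ m, a = b + m := ⟨a - b, by ring⟩
  obtain ⟨n, rfl⟩ : ∃ n, b = c + n := ⟨b - c, by ring⟩
  ring

section

variable {u : ι → K →+* K} {x : ι → K} {h t : K}
  (hx : ∀ i j, u i (x j) = x j + if j = i then h else 0)
  (ht : ∀ i, u i t = t) (hh : ∀ i, u i h = h)
  (hcomm : ∀ i j f, u i (u j f) = u j (u i f))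
  (hne : ∀ i j, i ≠ j → ∀ n : ℤ, x i - x j + n * h ≠ 0)

include hx hh in
theorem serreTerm_self (f : K) (i : ι) : serreTerm u x h t f i i i = 0 := by
  have : u i (u i (x i + h)) - 2 * u i (x i + h) + (x i + h) = 0 := by
    simp only [map_add, hx, hh, if_true]; ring
  rw [serreTerm, this, zero_mul]

include hx ht hh hcomm hne in
theorem serreTerm_sum_of_pair (f : K) {i j : ι} (hij : i ≠ j) :
    serreTerm u x h t f i i j + serreTerm u x h t f i j i + serreTerm u x h t f j i i = 0 := by
  have hji := hij.symm
  have qi : u j (∏ l ∈ ({i, j}ᶜ : Finset ι), pairFactor x t i l) =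
      ∏ l ∈ ({i, j}ᶜ : Finset ι), pairFactor x t i l :=
    map_prod_pairFactor hx ht hij (by simp)
  have qj : u i (∏ l ∈ ({j, i}ᶜ : Finset ι), pairFactor x t j l) =
      ∏ l ∈ ({j, i}ᶜ : Finset ι), pairFactor x t j l :=
    map_prod_pairFactor hx ht hji (by simp)
  simp only [serreTerm, shiftCoeff_eq_of_pair x t hij, shiftCoeff_eq_of_pair x t hji]
  generalize ∏ l ∈ ({i, j}ᶜ : Finset ι), pairFactor x t i l = Q at *
  generalize ∏ l ∈ ({j, i}ᶜ : Finset ι), pairFactor x t j l = R at *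
  rw [hcomm j i f, hcomm j i (u i f), hcomm j i f, hcomm j i (_ * Q)]
  simp only [map_mul, map_add, qi, qj, map_pairFactor _ x t (ht _), map_div₀, map_sub, ht, hh, hx,
    if_true, if_neg hij, if_neg hji, add_zero]
  simp only [pairFactor]
  obtain ⟨d, hd⟩ : ∃ d, x i = x j + d := ⟨x i - x j, by ring⟩
  have n0 : d ≠ 0 := by simpa [hd] using hne i j hij 0
  have n1 : d + h ≠ 0 := by simpa [hd] using hne i j hij 1
  have n2 : d + h * 2 ≠ 0 := by simpa [hd, mul_comm] using hne i j hij 2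
  have n3 : d - h ≠ 0 := by simpa [hd, sub_eq_add_neg] using hne i j hij (-1)
  have e1 : x j + d - x j = d := by ring
  have e2 : x j + d + h - x j = d + h := by ring
  have e3 : x j - (x j + d + h + h) = -(d + h * 2) := by ring
  have e4 : x j - (x j + d + h) = -(d + h) := by ring
  have e5 : x j + d + h - (x j + h) = d := by ring
  have e6 : x j - (x j + d) = -d := by ring
  have e7 : x j + d - (x j + h) = d - h := by ring
  rw [hd, e1, e2, e3, e4, e5, e6, e7]
  field_simp
  ring

include hx ht hh hcomm hne in
theorem serreTerm_sum_of_distinct (f : K) {i j k : ι} (hij : i ≠ j) (hik : i ≠ k) (hjk : j ≠ k) :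
    serreTerm u x h t f i j k + serreTerm u x h t f i k j + serreTerm u x h t f j i k +
      serreTerm u x h t f j k i + serreTerm u x h t f k i j + serreTerm u x h t f k j i = 0 := by
  have hji := hij.symm
  have hki := hik.symm
  have hkj := hjk.symm
  have fixed : ∀ a b : ι, a ≠ b → b ∈ ({i, j, k} : Finset ι) →
      u b (∏ l ∈ ({i, j, k}ᶜ : Finset ι), pairFactor x t a l) =
        ∏ l ∈ ({i, j, k}ᶜ : Finset ι), pairFactor x t a l := fun a b hab hb =>
    map_prod_pairFactor hx ht hab (by simpa only [Finset.mem_compl, not_not] using hb)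
  have fij := fixed i j hij (by simp)
  have fik := fixed i k hik (by simp)
  have fji := fixed j i hji (by simp)
  have fjk := fixed j k hjk (by simp)
  have fki := fixed k i hki (by simp)
  have fkj := fixed k j hkj (by simp)
  have ci := shiftCoeff_eq_of_triple x t hij hik hjk
  have cj := shiftCoeff_eq_of_triple x t hji hjk hik
  have ck := shiftCoeff_eq_of_triple x t hki hkj hij
  rw [Finset.insert_comm j i] at cj
  rw [Finset.insert_comm k i, Finset.pair_comm k j] at ck
  simp only [serreTerm, ci, cj, ck]
  generalize ∏ l ∈ ({i, j, k}ᶜ : Finset ι), pairFactor x t i l = P at *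
  generalize ∏ l ∈ ({i, j, k}ᶜ : Finset ι), pairFactor x t j l = Q at *
  generalize ∏ l ∈ ({i, j, k}ᶜ : Finset ι), pairFactor x t k l = R at *
  have hne0 : ∀ a b : ι, a ≠ b → x a - x b ≠ 0 := fun a b hab => by
    simpa using hne a b hab 0
  have hne1 : ∀ a b : ι, a ≠ b → x a - x b - h ≠ 0 := fun a b hab => by
    simpa [sub_eq_add_neg] using hne a b hab (-1)
  have key := serre_identity_of_distinct (t := t) (hne0 i j hij) (hne0 i k hik) (hne0 j k hjk)
    (hne1 i j hij) (hne1 i k hik) (hne1 j k hjk) (hne1 j i hji) (hne1 k i hki) (hne1 k j hkj)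
  rw [hcomm j i (u k f), hcomm k i (u j f), hcomm k j f, hcomm k i f, hcomm k j (u i f),
    hcomm k i f, hcomm j i (u k f)]
  simp only [map_mul, map_add, fij, fik, fji, fjk, fki, fkj, map_pairFactor _ x t (ht _), map_div₀,
    map_sub, ht, hh, hx, if_true, if_neg hij, if_neg hji, if_neg hik, if_neg hki, if_neg hjk,
    if_neg hkj, add_zero]
  simp only [pairFactor]
  simp only [← sub_sub]
  linear_combination P * Q * R * u i (u j (u k f)) * key

include hx ht hh hcomm hne in
theorem serreTerm_symm_sum (f : K) (i j k : ι) :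
    serreTerm u x h t f i j k + serreTerm u x h t f i k j + serreTerm u x h t f j i k +
      serreTerm u x h t f j k i + serreTerm u x h t f k i j + serreTerm u x h t f k j i = 0 := by
  have pair := fun {i j : ι} => serreTerm_sum_of_pair hx ht hh hcomm hne f (i := i) (j := j)
  rcases eq_or_ne i j with rfl | hij
  · rcases eq_or_ne i k with rfl | hik
    · simp only [serreTerm_self hx hh, add_zero]
    · linear_combination 2 * pair hik
  · rcases eq_or_ne i k with rfl | hik
    · linear_combination 2 * pair hij
    · rcases eq_or_ne j k with rfl | hjk
      · linear_combination 2 * pair hij.symm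
      · exact serreTerm_sum_of_distinct hx ht hh hcomm hne f hij hik hjk

include hx ht hh hcomm hne in
theorem sum_serreTerm [CharZero K] (f : K) :
    ∑ i, ∑ j, ∑ k, serreTerm u x h t f i j k = 0 := by
  set T := serreTerm u x h t f
  have s0 : ∀ F : ι → ι → ι → K, ∑ i, ∑ j, ∑ k, F j i k = ∑ i, ∑ j, ∑ k, F i j k :=
    fun F => Finset.sum_comm
  have s1 : ∀ F : ι → ι → ι → K, ∑ i, ∑ j, ∑ k, F i k j = ∑ i, ∑ j, ∑ k, F i j k :=
    fun F => Finset.sum_congr rfl fun _ _ => Finset.sum_comm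
  have e1 := s1 T
  have e2 := s0 T
  have e3 := (s0 fun a b c => T a c b).trans e1
  have e4 := (s1 fun a b c => T b a c).trans e2
  have e5 := (s1 fun a b c => T b c a).trans e3
  have total : ∑ i, ∑ j, ∑ k, (T i j k + T i k j + T j i k + T j k i + T k i j + T k j i) = 0 :=
    Finset.sum_eq_zero fun i _ => Finset.sum_eq_zero fun j _ => Finset.sum_eq_zero fun k _ =>
      serreTerm_symm_sum hx ht hh hcomm hne f i j k
  simp only [Finset.sum_add_distrib] at total
  have six : (6 : K) * ∑ i, ∑ j, ∑ k, T i j k = 0 := by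
    linear_combination total - e1 - e2 - e3 - e4 - e5
  simpa using six

end

end ShiftOperators

theorem ww_sub_add_ne_zero {i j : Fin N} (hij : i ≠ j) (c : k0 l) :
    ww l N i - ww l N j + algebraMap (k0 l) (KK l N) c ≠ 0 := by
  intro h
  rw [IsScalarTower.algebraMap_apply (k0 l) (MvPolynomial (Fin N) (k0 l)) (KK l N), ww, ww,
    ← map_sub, ← map_add] at h
  have h0 : (X i - X j + C c : MvPolynomial (Fin N) (k0 l)) = 0 :=
    (map_eq_zero_iff _ (IsFractionRing.injective _ (KK l N))).mp h
  have := congrArg (coeff (Finsupp.single i 1)) h0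
  have hs : (0 : Fin N →₀ ℕ) ≠ Finsupp.single i 1 := (Finsupp.single_ne_zero.mpr one_ne_zero).symm
  simp [coeff_X, coeff_C, Finsupp.single_left_inj, hij.symm, hs] at this

theorem KK.algHom_ext {σ τ : KK l N →ₐ[k0 l] KK l N} (h : ∀ i, σ (ww l N i) = τ (ww l N i)) :
    σ = τ := by
  have : σ.toRingHom = τ.toRingHom := by
    refine IsLocalization.ringHom_ext (nonZeroDivisors (MvPolynomial (Fin N) (k0 l))) ?_
    refine MvPolynomial.ringHom_ext (fun c => ?_) h
    have hc : algebraMap (MvPolynomial (Fin N) (k0 l)) (KK l N) (C c) =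
        algebraMap (k0 l) (KK l N) c :=
      (IsScalarTower.algebraMap_apply _ _ _ c).symm
    simp [hc]
  exact AlgHom.ext fun f => congrArg (fun ρ : KK l N →+* KK l N => ρ f) this

theorem shift_comm (hu : ∀ i j, u i (ww 0 N j) = ww 0 N j + if j = i then hbar 0 N else 0)
    (i j : Fin N) (f : KK 0 N) : u i (u j f) = u j (u i f) := by
  have hb : ∀ i, u i (hbar 0 N) = hbar 0 N := fun i => (u i).commutes _
  have : (u i).toAlgHom.comp (u j).toAlgHom = (u j).toAlgHom.comp (u i).toAlgHom := by
    refine KK.algHom_ext 0 N fun k => ?_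
    have hi : ∀ a b c : Fin N, u c (if a = b then hbar 0 N else 0) = if a = b then hbar 0 N else 0 :=
      fun a b c => by split_ifs <;> simp [hb]
    change u i (u j (ww 0 N k)) = u j (u i (ww 0 N k))
    rw [hu, hu, map_add, map_add, hu, hu, hi, hi, add_right_comm]
  exact congrArg (fun ρ : KK 0 N →ₐ[k0 0] KK 0 N => ρ f) this

theorem eop_apply (n : ℕ) (f : KK 0 N) :
    eop N u n f = ∑ i, (wbar N i + hbar 0 N) ^ n * shiftCoeff (wbar N) (tt 0 N) i * u i f := by
  simp only [eop, mulOp, shiftCoeff, pairFactor, LinearMap.sum_apply, Module.End.mul_apply,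
    LinearMap.mulLeft_apply, AlgEquiv.toLinearMap_apply]

theorem statement10 (hN : 1 ≤ N)
    (hu : ∀ i j, u i (ww 0 N j) = ww 0 N j + if j = i then hbar 0 N else 0) :
    eop N u 0 * (eop N u 0 * eop N u 1 - eop N u 1 * eop N u 0)
      - (eop N u 0 * eop N u 1 - eop N u 1 * eop N u 0) * eop N u 0 = 0 := by
  have ht : ∀ i, u i (tt 0 N) = tt 0 N := fun i => (u i).commutes _
  have hh : ∀ i, u i (hbar 0 N) = hbar 0 N := fun i => (u i).commutes _
  have hx : ∀ i j, u i (wbar N j) = wbar N j + if j = i then hbar 0 N else 0 := fun i j => by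
    simp only [wbar, map_sub, map_mul, map_natCast, hu, ht]
    ring
  have hne : ∀ i j, i ≠ j → ∀ n : ℤ, wbar N i - wbar N j + n * hbar 0 N ≠ 0 :=
    fun i j hij n => by
      simpa [wbar, hbar] using ww_sub_add_ne_zero 0 N hij (n * hb0 0)
  refine LinearMap.ext fun f => ?_
  have key := sum_serreTerm (u := fun i => (u i : KK 0 N →+* KK 0 N)) hx ht hh
    (shift_comm N u hu) hne f
  rw [LinearMap.zero_apply, ← key]
  simp only [LinearMap.sub_apply, Module.End.mul_apply, eop_apply]
  simp only [map_sub, map_sum, map_mul, Finset.mul_sum, ← Finset.sum_sub_distrib, serreTerm,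
    pow_zero, pow_one, one_mul]
  refine Finset.sum_congr rfl fun i _ => Finset.sum_congr rfl fun j _ =>
    Finset.sum_congr rfl fun k _ => ?_
  simp only [RingHom.coe_coe]
  ring
end
end
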